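/- arXiv:1308.4430 — 2 statements merged into one kernel-verified Lean document; each statement's English description precedes it below -/
import Mathlib

section
/- Let a > 0, 0 ≤ γ < 1/2 and δ > 0 with γ + δ < 1/2. Let F : [1,∞) × ℝ → ℂ be measurable, such that for almost every ξ ∈ ℝ the functions t ↦ F(t,ξ) and t ↦ F(t,−ξ) are C¹ and satisfy F_t(t,ξ) = −i ξ² F(t,ξ) + i a² t^{−1−2ia²} conj(F(t,−ξ)). Assume M_γ := ess sup_{|ξ| ≤ 1} |ξ|^{γ} |F(1,ξ)| < ∞. Then there is a constant C, depending only on a, γ, δ, such that for all 1 ≤ t₁ ≤ t₂, the function A_{t₁,t₂}(ξ) = ∫_{t₁}^{t₂} e^{i s ξ²} conj(F(s,−ξ)) s^{−1−2ia²} ds satisfies ‖A_{t₁,t₂}‖_{L²({1/t₁ ≤ ξ² ≤ 1})} ≤ C t₁^{−1/4 + (γ+δ)/2} M_γ. -/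
open MeasureTheory

noncomputable section

lemma gron (f f' φ φ' : ℝ → ℝ) (A B : ℝ) (h1 : 1 ≤ A) (hAB : A ≤ B)
    (hf : ∀ t, 1 ≤ t → HasDerivWithinAt f (f' t) (Set.Ici 1) t)
    (hφ : ∀ t, 1 ≤ t → HasDerivAt φ (φ' t) t)
    (h : ∀ t, A < t → t < B → f' t ≤ φ' t * f t) :
    f B ≤ f A * Real.exp (φ B - φ A) := by
  have hd : ∀ t, 1 ≤ t → HasDerivWithinAt (fun s => f s * Real.exp (-φ s))
      (f' t * Real.exp (-φ t) + f t * (Real.exp (-φ t) * (-φ' t))) (Set.Ici 1) t := by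
    intro t ht
    exact (hf t ht).mul ((hφ t ht).neg.exp.hasDerivWithinAt)
  have hanti : AntitoneOn (fun s => f s * Real.exp (-φ s)) (Set.Icc A B) := by
    apply antitoneOn_of_hasDerivWithinAt_nonpos (convex_Icc A B)
      (f' := fun t => f' t * Real.exp (-φ t) + f t * (Real.exp (-φ t) * (-φ' t)))
    · intro t ht
      exact ((hd t (h1.trans ht.1)).continuousWithinAt).mono
        (fun s hs => h1.trans hs.1)
    · intro t ht
      rw [interior_Icc] at ht ⊢
      exact (hd t (h1.trans ht.1.le)).mono (fun s hs => h1.trans hs.1.le)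
    · intro t ht
      rw [interior_Icc] at ht
      have := h t ht.1 ht.2
      have e := Real.exp_pos (-φ t)
      nlinarith
  have := hanti (Set.left_mem_Icc.2 hAB) (Set.right_mem_Icc.2 hAB) hAB
  simp only at this
  have e := Real.exp_pos (φ B)
  calc f B = (f B * Real.exp (-φ B)) * Real.exp (φ B) := by
        rw [mul_assoc, ← Real.exp_add]; simp
    _ ≤ (f A * Real.exp (-φ A)) * Real.exp (φ B) := by gcongr
    _ = _ := by rw [mul_assoc, ← Real.exp_add]; ring_nf

set_option maxHeartbeats 1000000 in
lemma growth (a δ : ℝ) (ha : 0 < a) (hδ : 0 < δ) :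
    ∃ C : ℝ, 0 < C ∧ ∀ (x : ℝ) (S D : ℝ → ℂ), 0 < x → x ≤ 1 →
      (∀ t : ℝ, 1 ≤ t → HasDerivWithinAt S (-(Complex.I * x) * D t) (Set.Ici 1) t) →
      (∀ t : ℝ, 1 ≤ t → HasDerivWithinAt D (Complex.I * ((2*a^2/t - x : ℝ) : ℂ) * S t)
        (Set.Ici 1) t) →
      ∀ t : ℝ, 1 ≤ t → ‖S t‖^2 + ‖D t‖^2 ≤ C * x ^ (-δ) * (‖S 1‖^2 + ‖D 1‖^2) := by
  obtain ⟨ε, hε, hε1, hεδ⟩ : ∃ ε : ℝ, 0 < ε ∧ ε ≤ 1 ∧ 2*a^2*ε ≤ δ := by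
    refine ⟨min 1 (δ/(2*a^2)), by positivity, min_le_left _ _, ?_⟩
    calc 2*a^2*min 1 (δ/(2*a^2)) ≤ 2*a^2*(δ/(2*a^2)) := by
          gcongr; exact min_le_right _ _
      _ = δ := by field_simp
  obtain ⟨K, hK1, hKa⟩ : ∃ K : ℝ, 1 ≤ K ∧ 4*a^2 ≤ K :=
    ⟨max 1 (4*a^2), le_max_left _ _, le_max_right _ _⟩
  have hK : 0 < K := by linarith
  set c1 : ℝ := (1+ε^2)/ε with hc1
  have hc1p : 0 < c1 := by positivity
  set C1 : ℝ := (ε^2)⁻¹ * (Real.exp (c1*K) * K^δ) with hC1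
  have hC1p : 0 < C1 := by positivity
  refine ⟨(2*Real.exp 1 + 1) * C1, by positivity, ?_⟩
  intro x S D hx hx1 hS hD
  have hKx : 1 ≤ K/x := by rw [le_div_iff₀ hx]; nlinarith
  set c : ℝ → ℝ := fun t => (S t).re * (D t).im - (S t).im * (D t).re with hc
  have hSn : ∀ t : ℝ, 1 ≤ t → HasDerivWithinAt (fun s => ‖S s‖^2) (2*x*c t) (Set.Ici 1) t := by
    intro t ht
    have := (hS t ht).norm_sq
    convert this using 1
    simp [hc, Complex.inner]
    ring
  have hDn : ∀ t : ℝ, 1 ≤ t → HasDerivWithinAt (fun s => ‖D s‖^2) (2*(2*a^2/t - x)*c t)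
      (Set.Ici 1) t := by
    intro t ht
    have := (hD t ht).norm_sq
    convert this using 1
    rw [Complex.inner]
    simp only [hc, Complex.mul_re, Complex.mul_im, Complex.I_re, Complex.I_im, Complex.ofReal_re,
      Complex.ofReal_im, Complex.conj_re, Complex.conj_im]
    ring
  have hcb : ∀ t, |c t| ≤ ‖S t‖ * ‖D t‖ := by
    intro t
    apply abs_le_of_sq_le_sq _ (by positivity)
    rw [mul_pow, Complex.sq_norm, Complex.sq_norm, Complex.normSq_apply, Complex.normSq_apply]
    simp only [hc]
    nlinarith [sq_nonneg ((S t).re * (D t).re + (S t).im * (D t).im)]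
  -- stage 1
  have st1 : ∀ t : ℝ, 1 ≤ t → t ≤ K/x →
      ‖S t‖^2 + ‖D t‖^2 ≤ C1 * x^(-δ) * (‖S 1‖^2 + ‖D 1‖^2) := by
    intro t ht htK
    have g := gron (fun s => ‖S s‖^2 + ε^2*‖D s‖^2)
      (fun s => 2*x*c s + ε^2 * (2*(2*a^2/s - x)*c s))
      (fun s => c1*x*s + 2*a^2*ε*Real.log s)
      (fun s => c1*x*1 + 2*a^2*ε*s⁻¹) 1 t le_rfl ht
      (fun s hs => (hSn s hs).add ((hDn s hs).const_mul _))
      (fun s hs => ((hasDerivAt_id s).const_mul _).add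
        ((Real.hasDerivAt_log (by linarith)).const_mul _))
      (by
        intro s hs _
        have hs0 : 0 < s := by linarith
        have h1 := hcb s
        have h2 : 2 * (ε * (‖S s‖*‖D s‖)) ≤ ‖S s‖^2 + ε^2*‖D s‖^2 := by
          nlinarith [sq_nonneg (‖S s‖ - ε*‖D s‖)]
        have h3 : |2*x + ε^2*(2*(2*a^2/s - x))| ≤ 2*ε*(c1*x + 2*a^2*ε*s⁻¹) := by
          have e1 : 2*ε*(c1*x + 2*a^2*ε*s⁻¹) = 2*x + 2*ε^2*x + ε^2*(4*a^2*s⁻¹) := by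
            rw [hc1]; field_simp; ring
          have e2 : 2*x + ε^2*(2*(2*a^2/s - x)) = 2*x - 2*ε^2*x + ε^2*(4*a^2*s⁻¹) := by
            rw [div_eq_mul_inv]; ring
          rw [e1, e2]
          have p1 : 0 ≤ ε^2*x := by positivity
          have p2 : 0 ≤ ε^2*(4*a^2*s⁻¹) := by positivity
          rw [abs_le]; constructor <;> linarith
        calc 2*x*c s + ε^2 * (2*(2*a^2/s - x)*c s)
            = (2*x + ε^2*(2*(2*a^2/s - x))) * c s := by ring
          _ ≤ |(2*x + ε^2*(2*(2*a^2/s - x))) * c s| := le_abs_self _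
          _ = |2*x + ε^2*(2*(2*a^2/s - x))| * |c s| := abs_mul _ _
          _ ≤ (2*ε*(c1*x + 2*a^2*ε*s⁻¹)) * (‖S s‖*‖D s‖) := by gcongr
          _ = (c1*x*1 + 2*a^2*ε*s⁻¹) * (2 * (ε * (‖S s‖*‖D s‖))) := by ring
          _ ≤ (c1*x*1 + 2*a^2*ε*s⁻¹) * (‖S s‖^2 + ε^2*‖D s‖^2) := by gcongr)
    have hexp : Real.exp (c1*x*t + 2*a^2*ε*Real.log t - (c1*x*1 + 2*a^2*ε*Real.log 1))
        ≤ Real.exp (c1*K) * K^δ * x^(-δ) := by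
      rw [Real.rpow_def_of_pos hK, Real.rpow_def_of_pos hx, ← Real.exp_add, ← Real.exp_add]
      apply Real.exp_le_exp.2
      have l0 : 0 ≤ Real.log t := Real.log_nonneg ht
      have l1 : Real.log t ≤ Real.log K - Real.log x := by
        rw [← Real.log_div hK.ne' hx.ne']
        exact Real.log_le_log (by linarith) htK
      have l2 : 2*a^2*ε*Real.log t ≤ δ*(Real.log K - Real.log x) := by
        apply mul_le_mul hεδ l1 l0 hδ.le
      have l3 : x*t ≤ K := by rw [le_div_iff₀ hx] at htK; linarith
      have l4 : c1*(x*t) ≤ c1*K := by gcongr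
      have l5 : 0 < c1*x := by positivity
      rw [Real.log_one]
      nlinarith
    have hε2 : ε^2 ≤ 1 := by nlinarith
    have g2 : ε^2 * (‖S t‖^2 + ‖D t‖^2) ≤
        (‖S 1‖^2 + ‖D 1‖^2) * (Real.exp (c1*K) * K^δ * x^(-δ)) := by
      calc ε^2 * (‖S t‖^2 + ‖D t‖^2) ≤ ‖S t‖^2 + ε^2*‖D t‖^2 := by
            nlinarith [sq_nonneg ‖S t‖]
        _ ≤ _ := g
        _ ≤ (‖S 1‖^2 + ‖D 1‖^2) * (Real.exp (c1*K) * K^δ * x^(-δ)) := by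
            gcongr
            nlinarith [sq_nonneg ‖D 1‖]
    calc ‖S t‖^2 + ‖D t‖^2 = (ε^2)⁻¹ * (ε^2 * (‖S t‖^2 + ‖D t‖^2)) := by field_simp
      _ ≤ (ε^2)⁻¹ * ((‖S 1‖^2 + ‖D 1‖^2) * (Real.exp (c1*K) * K^δ * x^(-δ))) := by gcongr
      _ = _ := by rw [hC1]; ring
  intro t ht
  have hR : 0 ≤ C1 * x^(-δ) * (‖S 1‖^2 + ‖D 1‖^2) := by positivity
  have hexp0 := Real.exp_pos 1
  rcases le_total t (K/x) with h | h
  · have := st1 t ht h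
    nlinarith
  · have w : ∀ s, K/x ≤ s → 2*a^2/(x*s) ≤ 1/2 := by
      intro s hs
      rw [div_le_iff₀ hx] at hs
      rw [div_le_iff₀ (by nlinarith)]
      nlinarith
    have g := gron (fun s => ‖D s‖^2 + (1 - 2*a^2/x*s⁻¹)*‖S s‖^2)
      (fun s => 2*(2*a^2/s - x)*c s + ((-(2*a^2/x*(-(s^2)⁻¹))) * ‖S s‖^2 +
        (1 - 2*a^2/x*s⁻¹) * (2*x*c s)))
      (fun s => -(4*a^2/x*s⁻¹))
      (fun s => -(4*a^2/x*(-(s^2)⁻¹))) (K/x) t hKx h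
      (fun s hs => (hDn s hs).add
        (((((hasDerivAt_inv (by linarith)).const_mul _).const_sub 1).hasDerivWithinAt).mul
          (hSn s hs)))
      (fun s hs => ((hasDerivAt_inv (by linarith)).const_mul _).neg)
      (by
        intro s hs _
        have hs0 : 0 < s := by linarith
        have hw := w s hs.le
        have e1 : 2*a^2/x*s⁻¹ = 2*a^2/(x*s) := by field_simp
        have e2 : 2*(2*a^2/s - x)*c s + ((-(2*a^2/x*(-(s^2)⁻¹))) * ‖S s‖^2 +
          (1 - 2*a^2/x*s⁻¹) * (2*x*c s)) = 2*a^2/x*(s^2)⁻¹ * ‖S s‖^2 := by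
          have hxx : x * x⁻¹ = 1 := mul_inv_cancel₀ hx.ne'
          simp only [div_eq_mul_inv]
          linear_combination (-4*a^2*s⁻¹*c s) * hxx
        rw [e2, e1]
        have e3 : -(4*a^2/x*(-(s^2)⁻¹)) = (2*a^2/x*(s^2)⁻¹) * 2 := by ring
        rw [e3, mul_assoc (2*a^2/x*(s^2)⁻¹) 2]
        have : 0 ≤ 2*a^2/x*(s^2)⁻¹ := by positivity
        apply mul_le_mul_of_nonneg_left _ this
        nlinarith [sq_nonneg ‖S s‖, sq_nonneg ‖D s‖])
    have hT := st1 (K/x) hKx le_rfl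
    have e1 : ∀ s, 2*a^2/x*s⁻¹ = 2*a^2/(x*s) := fun s => by field_simp
    have hexp : Real.exp (-(4*a^2/x*t⁻¹) - -(4*a^2/x*(K/x)⁻¹)) ≤ Real.exp 1 := by
      apply Real.exp_le_exp.2
      have p : 0 ≤ 4*a^2/x*t⁻¹ := by positivity
      have q : 4*a^2/x*(K/x)⁻¹ = 4*a^2/K := by field_simp
      have r : 4*a^2/K ≤ 1 := by rw [div_le_one hK]; exact hKa
      rw [q]; linarith
    have hwt := w t h
    rw [← e1] at hwt
    have p0 : 0 ≤ 2*a^2/x*(K/x)⁻¹ := by positivity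
    have lo : ‖S t‖^2 + ‖D t‖^2 ≤ 2 * (‖D t‖^2 + (1 - 2*a^2/x*t⁻¹)*‖S t‖^2) := by
      nlinarith [sq_nonneg ‖S t‖, sq_nonneg ‖D t‖]
    have hi : ‖D (K/x)‖^2 + (1 - 2*a^2/x*(K/x)⁻¹)*‖S (K/x)‖^2 ≤
        ‖S (K/x)‖^2 + ‖D (K/x)‖^2 := by
      nlinarith [mul_nonneg p0 (sq_nonneg ‖S (K/x)‖)]
    calc ‖S t‖^2 + ‖D t‖^2 ≤ 2 * (‖D t‖^2 + (1 - 2*a^2/x*t⁻¹)*‖S t‖^2) := lo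
      _ ≤ 2 * ((‖D (K/x)‖^2 + (1 - 2*a^2/x*(K/x)⁻¹)*‖S (K/x)‖^2) *
          Real.exp (-(4*a^2/x*t⁻¹) - -(4*a^2/x*(K/x)⁻¹))) := by gcongr
      _ ≤ 2 * ((C1 * x^(-δ) * (‖S 1‖^2 + ‖D 1‖^2)) * Real.exp 1) := by
          gcongr
          exact hi.trans hT
      _ ≤ _ := by nlinarith

set_option maxHeartbeats 1000000 in
lemma ptwise (a δ : ℝ) (ha : 0 < a) (hδ : 0 < δ) :
    ∃ C : ℝ, 0 < C ∧ ∀ (x : ℝ) (u w : ℝ → ℂ), 0 < x → x ≤ 1 →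
      (∀ t : ℝ, 1 ≤ t → HasDerivWithinAt u
        (-(Complex.I * (x:ℂ)) * u t
            + Complex.I * (a:ℂ)^2 * (t:ℂ) ^ ((-1:ℂ) - 2*Complex.I*(a:ℂ)^2)
                * (starRingEnd ℂ) (w t)) (Set.Ici 1) t) →
      (∀ t : ℝ, 1 ≤ t → HasDerivWithinAt w
        (-(Complex.I * (x:ℂ)) * w t
            + Complex.I * (a:ℂ)^2 * (t:ℂ) ^ ((-1:ℂ) - 2*Complex.I*(a:ℂ)^2)
                * (starRingEnd ℂ) (u t)) (Set.Ici 1) t) →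
      ∀ B : ℝ, ‖u 1‖ ≤ B → ‖w 1‖ ≤ B → ∀ t₁ t₂ : ℝ, 1 ≤ t₁ → t₁ ≤ t₂ →
      ‖∫ s in t₁..t₂, Complex.exp (Complex.I * (s:ℂ) * (x:ℂ)) * (starRingEnd ℂ) (w s)
              * (s:ℂ) ^ ((-1:ℂ) - 2*Complex.I*(a:ℂ)^2)‖ ≤ C * x ^ (-(δ/2)) * B / (x * t₁) := by
  obtain ⟨C0, hC0, hgr⟩ := growth a δ ha hδ
  refine ⟨(3 + 3*a^2) * Real.sqrt (2*C0), by positivity, ?_⟩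
  intro x u w hx hx1 hu hw B hB1 hB2 t₁ t₂ ht1 ht12
  have hB : 0 ≤ B := (norm_nonneg _).trans hB1
  set E : ℝ → ℂ := fun t => Complex.exp (Complex.I * (a:ℂ)^2 * (Real.log t : ℝ)) with hE
  set E' : ℝ → ℂ := fun t => Complex.exp (-(Complex.I * (a:ℂ)^2 * (Real.log t : ℝ))) with hE'
  set P : ℝ → ℂ := fun t => (t:ℂ) ^ ((-1:ℂ) - 2*Complex.I*(a:ℂ)^2) with hP
  have hEE : ∀ t, E t * E' t = 1 := fun t => by
    simp only [hE, hE']; rw [← Complex.exp_add]; simp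
  have hEn : ∀ t, ‖E t‖ = 1 := fun t => by
    simp only [hE]; rw [Complex.norm_exp]
    simp [← Complex.ofReal_pow]
  have hEn' : ∀ t, ‖E' t‖ = 1 := fun t => by
    simp only [hE']; rw [Complex.norm_exp]
    simp [← Complex.ofReal_pow]
  have hEc : ∀ t, (starRingEnd ℂ) (E' t) = E t := fun t => by
    simp only [hE, hE']; rw [← Complex.exp_conj]
    simp
  have hPE : ∀ t : ℝ, 1 ≤ t → P t = (t:ℂ)⁻¹ * E' t ^ 2 := fun t ht => by
    have h0 : (t:ℂ) ≠ 0 := by exact_mod_cast (by linarith : t ≠ 0)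
    simp only [hP, hE']
    rw [Complex.cpow_def_of_ne_zero h0, ← Complex.ofReal_log (by linarith), sub_eq_add_neg, mul_add,
      Complex.exp_add, ← Complex.exp_nat_mul]
    congr 1
    · rw [mul_neg_one, Complex.exp_neg, Complex.ofReal_log (by linarith), Complex.exp_log h0]
    · congr 1; push_cast; ring
  have hPc : ∀ t : ℝ, 1 ≤ t → (starRingEnd ℂ) (P t) = (t:ℂ)⁻¹ * E t ^ 2 := fun t ht => by
    rw [hPE t ht, map_mul, map_pow, hEc]; simp
  have hPn : ∀ t : ℝ, 1 ≤ t → ‖P t‖ = t⁻¹ := fun t ht => by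
    rw [hPE t ht, norm_mul, norm_pow, hEn']; simp; linarith
  have hlog : ∀ t : ℝ, 1 ≤ t → HasDerivAt (fun s : ℝ => ((Real.log s : ℝ) : ℂ)) ((t⁻¹ : ℝ) : ℂ) t :=
    fun t ht => (Real.hasDerivAt_log (by linarith)).ofReal_comp
  have hEd : ∀ t : ℝ, 1 ≤ t → HasDerivAt E (E t * (Complex.I * (a:ℂ)^2 * ((t⁻¹ : ℝ) : ℂ))) t :=
    fun t ht => ((hlog t ht).const_mul _).cexp
  have hEd' : ∀ t : ℝ, 1 ≤ t → HasDerivAt E' (E' t * (-(Complex.I * (a:ℂ)^2 * ((t⁻¹ : ℝ) : ℂ)))) t :=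
    fun t ht => ((hlog t ht).const_mul _).neg.cexp
  have hwc : ∀ t : ℝ, 1 ≤ t → HasDerivWithinAt (fun s => (starRingEnd ℂ) (w s))
      (Complex.I * x * (starRingEnd ℂ) (w t)
        - Complex.I * (a:ℂ)^2 * (starRingEnd ℂ) (P t) * u t) (Set.Ici 1) t := fun t ht => by
    have := (hw t ht).star
    refine HasDerivWithinAt.congr_deriv this (Eq.symm ?_)
    change _ = (starRingEnd ℂ) _
    simp [hP]
    ring
  -- bound
  set R : ℝ := Real.sqrt (2*C0) * x ^ (-(δ/2)) * B with hR
  have hR0 : 0 ≤ R := by positivity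
  have hR2 : R^2 = C0 * x^(-δ) * (2*B^2) := by
    rw [hR, mul_pow, mul_pow, Real.sq_sqrt (by positivity), ← Real.rpow_natCast (x^(-(δ/2))),
      ← Real.rpow_mul hx.le]
    have : -(δ/2) * ((2:ℕ):ℝ) = -δ := by push_cast; ring
    rw [this]; ring
  have par : ∀ t, ‖E t * u t + E' t * (starRingEnd ℂ) (w t)‖^2 +
      ‖E t * u t - E' t * (starRingEnd ℂ) (w t)‖^2 = 2*(‖u t‖^2 + ‖w t‖^2) := fun t => by
    have := parallelogram_law_with_norm ℝ (E t * u t) (E' t * (starRingEnd ℂ) (w t))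
    simp only [norm_mul, hEn, hEn', RCLike.norm_conj, one_mul] at this
    nlinarith
  have hbd : ∀ t : ℝ, 1 ≤ t → ‖u t‖^2 + ‖w t‖^2 ≤ R^2 := by
    have := hgr x (fun t => E t * u t + E' t * (starRingEnd ℂ) (w t))
      (fun t => E t * u t - E' t * (starRingEnd ℂ) (w t)) hx hx1
      (by
        intro t ht
        have h0 : (t:ℂ) ≠ 0 := by exact_mod_cast (by linarith : t ≠ 0)
        have h := ((hEd t ht).hasDerivWithinAt.mul (hu t ht)).add
          ((hEd' t ht).hasDerivWithinAt.mul (hwc t ht))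
        refine HasDerivWithinAt.congr_deriv h (Eq.symm ?_)
        rw [hPc t ht]
        change _ = _ + E t * (_ + _ * P t * _) + _
        rw [hPE t ht]
        push_cast
        linear_combination (-Complex.I * (a:ℂ)^2 * (t:ℂ)⁻¹ * E' t * (starRingEnd ℂ) (w t)
          + Complex.I * (a:ℂ)^2 * (t:ℂ)⁻¹ * E t * u t) * hEE t)
      (by
        intro t ht
        have h := ((hEd t ht).hasDerivWithinAt.mul (hu t ht)).sub
          ((hEd' t ht).hasDerivWithinAt.mul (hwc t ht))
        refine HasDerivWithinAt.congr_deriv h (Eq.symm ?_)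
        rw [hPc t ht]
        change _ = _ + E t * (_ + _ * P t * _) - _
        rw [hPE t ht]
        push_cast
        rw [div_eq_mul_inv]
        linear_combination (-Complex.I * (a:ℂ)^2 * (t:ℂ)⁻¹ * E' t * (starRingEnd ℂ) (w t)
          - Complex.I * (a:ℂ)^2 * (t:ℂ)⁻¹ * E t * u t) * hEE t)
    intro t ht
    have h := this t ht
    simp only [par] at h
    have h2 : ‖u 1‖^2 + ‖w 1‖^2 ≤ 2*B^2 := by
      have := pow_le_pow_left₀ (norm_nonneg _) hB1 2
      have := pow_le_pow_left₀ (norm_nonneg _) hB2 2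
      linarith
    rw [hR2]
    calc ‖u t‖^2 + ‖w t‖^2 ≤ C0 * x^(-δ) * (‖u 1‖^2 + ‖w 1‖^2) := by linarith
      _ ≤ _ := by gcongr
  have hub : ∀ t : ℝ, 1 ≤ t → ‖u t‖ ≤ R := fun t ht =>
    le_of_sq_le_sq (by nlinarith [hbd t ht, sq_nonneg ‖w t‖]) hR0
  have hwb : ∀ t : ℝ, 1 ≤ t → ‖w t‖ ≤ R := fun t ht =>
    le_of_sq_le_sq (by nlinarith [hbd t ht, sq_nonneg ‖u t‖]) hR0
  -- integration by parts
  have hPd : ∀ t : ℝ, 1 ≤ t → HasDerivWithinAt P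
      ((-1 - 2*Complex.I*(a:ℂ)^2) * (t:ℂ)⁻¹ * P t) (Set.Ici 1) t := fun t ht => by
    have h0 : (t:ℂ) ≠ 0 := by exact_mod_cast (by linarith : t ≠ 0)
    have h1 : HasDerivAt (fun s : ℝ => (s:ℂ)⁻¹) (-((t:ℂ)^2)⁻¹) t :=
      (hasDerivAt_inv h0).comp_ofReal
    have h2 := (h1.mul ((hEd' t ht).pow 2)).hasDerivWithinAt (s := Set.Ici 1)
    have h3 := h2.congr_of_mem (f₁ := P) (fun s hs => by simpa using hPE s hs) ht
    refine HasDerivWithinAt.congr_deriv h3 (Eq.symm ?_)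
    rw [hPE t ht]
    simp only [Pi.pow_apply]
    push_cast
    field_simp
    ring
  set X : ℝ → ℂ := fun s => Complex.exp (Complex.I * (s:ℂ) * (x:ℂ)) with hX
  have hXd : ∀ t : ℝ, HasDerivAt X (X t * (Complex.I * x)) t := fun t => by
    have h : HasDerivAt (fun s : ℝ => Complex.I * (s:ℂ) * (x:ℂ)) (Complex.I * 1 * x) t :=
      ((Complex.ofRealCLM.hasDerivAt (x := t)).const_mul _).mul_const _
    simpa using h.cexp
  have hXn : ∀ t, ‖X t‖ = 1 := fun t => by
    simp only [hX]; rw [Complex.norm_exp]; simp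
  set G : ℝ → ℂ := fun s => X s * (starRingEnd ℂ) (w s) * P s with hG
  set Rm : ℝ → ℂ := fun s => X s * (-(Complex.I * (a:ℂ)^2 * (starRingEnd ℂ) (P s) * u s)) * P s
    + X s * (starRingEnd ℂ) (w s) * ((-1 - 2*Complex.I*(a:ℂ)^2) * (s:ℂ)⁻¹ * P s) with hRm
  have hGd : ∀ t : ℝ, 1 ≤ t → HasDerivWithinAt G (2*Complex.I*x * G t + Rm t) (Set.Ici 1) t :=
    fun t ht => by
      have h := (((hXd t).hasDerivWithinAt (s := Set.Ici 1)).mul (hwc t ht)).mul (hPd t ht)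
      refine HasDerivWithinAt.congr_deriv h (Eq.symm ?_)
      change 2*Complex.I*x * (X t * (starRingEnd ℂ) (w t) * P t) + (_ + _) = (_ + _) * P t + X t * (starRingEnd ℂ) (w t) * _
      ring
  have hsub : Set.uIcc t₁ t₂ ⊆ Set.Ici 1 := by
    rw [Set.uIcc_of_le ht12]; exact fun s hs => ht1.trans hs.1
  have cG : ContinuousOn G (Set.uIcc t₁ t₂) := fun s hs =>
    ((hGd s (hsub hs)).continuousWithinAt).mono hsub
  have cP : ContinuousOn P (Set.uIcc t₁ t₂) := fun s hs =>
    ((hPd s (hsub hs)).continuousWithinAt).mono hsub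
  have cu : ContinuousOn u (Set.uIcc t₁ t₂) := fun s hs =>
    ((hu s (hsub hs)).continuousWithinAt).mono hsub
  have cw : ContinuousOn (fun s => (starRingEnd ℂ) (w s)) (Set.uIcc t₁ t₂) := fun s hs =>
    ((hwc s (hsub hs)).continuousWithinAt).mono hsub
  have cX : ContinuousOn X (Set.uIcc t₁ t₂) := fun s hs =>
    (hXd s).continuousAt.continuousWithinAt
  have cPc : ContinuousOn (fun s => (starRingEnd ℂ) (P s)) (Set.uIcc t₁ t₂) :=
    Complex.continuous_conj.comp_continuousOn cP
  have ci : ContinuousOn (fun s : ℝ => (s:ℂ)⁻¹) (Set.uIcc t₁ t₂) := by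
    apply ContinuousOn.inv₀ (Complex.continuous_ofReal.continuousOn)
    intro s hs
    have : 1 ≤ s := hsub hs
    exact_mod_cast (by linarith : s ≠ 0)
  have cR : ContinuousOn Rm (Set.uIcc t₁ t₂) := by
    simp only [hRm]
    exact ((cX.mul ((continuousOn_const.mul cPc).mul cu).neg).mul cP).add
      ((cX.mul cw).mul ((continuousOn_const.mul ci).mul cP))
  have iG := cG.intervalIntegrable (μ := volume)
  have iR := cR.intervalIntegrable (μ := volume)
  have ftc : ∫ s in t₁..t₂, (2*Complex.I*x * G s + Rm s) = G t₂ - G t₁ := by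
    apply intervalIntegral.integral_eq_sub_of_hasDeriv_right cG
    · intro s hs
      rw [min_eq_left ht12, max_eq_right ht12] at hs
      exact (hGd s (ht1.trans hs.1.le)).mono (fun y hy => (ht1.trans hs.1.le).trans (le_of_lt hy))
    · exact (iG.const_mul _).add iR
  rw [intervalIntegral.integral_add (iG.const_mul _) iR, intervalIntegral.integral_const_mul] at ftc
  have hGn : ∀ s : ℝ, 1 ≤ s → ‖G s‖ ≤ R * s⁻¹ := fun s hs => by
    have : 0 < s := by linarith
    simp only [hG]
    rw [norm_mul, norm_mul, hXn, hPn s hs, RCLike.norm_conj, one_mul]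
    gcongr
    exact hwb s hs
  have hRn : ∀ s : ℝ, 1 ≤ s → ‖Rm s‖ ≤ (1 + 3*a^2) * R * (s^2)⁻¹ := fun s hs => by
    have hs0 : 0 < s := by linarith
    have n1 : ‖(-1 - 2*Complex.I*(a:ℂ)^2)‖ ≤ 1 + 2*a^2 := by
      refine (norm_sub_le _ _).trans ?_
      simp
    have n2 : ‖(s:ℂ)⁻¹‖ = s⁻¹ := by
      rw [norm_inv, Complex.norm_real, Real.norm_of_nonneg hs0.le]
    simp only [hRm]
    refine (norm_add_le _ _).trans ?_
    have b1 : ‖X s * (-(Complex.I * (a:ℂ)^2 * (starRingEnd ℂ) (P s) * u s)) * P s‖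
        ≤ a^2 * R * (s^2)⁻¹ := by
      simp only [norm_mul, norm_neg, hXn, hPn s hs, RCLike.norm_conj, Complex.norm_I, norm_pow,
        Complex.norm_real, Real.norm_of_nonneg ha.le, one_mul]
      calc a^2 * s⁻¹ * ‖u s‖ * s⁻¹ ≤ a^2 * s⁻¹ * R * s⁻¹ := by gcongr; exact hub s hs
        _ = _ := by field_simp
    have b2 : ‖X s * (starRingEnd ℂ) (w s) * ((-1 - 2*Complex.I*(a:ℂ)^2) * (s:ℂ)⁻¹ * P s)‖
        ≤ (1 + 2*a^2) * R * (s^2)⁻¹ := by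
      rw [norm_mul, norm_mul, norm_mul, norm_mul, hXn, hPn s hs, RCLike.norm_conj, n2, one_mul]
      calc ‖w s‖ * (‖(-1 - 2*Complex.I*(a:ℂ)^2)‖ * s⁻¹ * s⁻¹)
          ≤ R * ((1 + 2*a^2) * s⁻¹ * s⁻¹) := by gcongr; exact hwb s hs
        _ = _ := by field_simp
    linarith
  have hpos1 : 0 < t₁ := by linarith
  have hpos2 : 0 < t₂ := by linarith
  have hIR : ‖∫ s in t₁..t₂, Rm s‖ ≤ (1 + 3*a^2) * R * t₁⁻¹ := by
    have cs : ContinuousOn (fun s : ℝ => (1 + 3*a^2) * R * (s^2)⁻¹) (Set.uIcc t₁ t₂) := by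
      apply continuousOn_const.mul
      apply ContinuousOn.inv₀ (by fun_prop)
      intro s hs
      have : 1 ≤ s := hsub hs
      positivity
    have h1 := intervalIntegral.norm_integral_le_of_norm_le ht12 (f := Rm) (μ := volume)
      (g := fun s => (1 + 3*a^2) * R * (s^2)⁻¹)
      (Filter.Eventually.of_forall (fun s hs => hRn s (ht1.trans hs.1.le)))
      cs.intervalIntegrable
    refine h1.trans ?_
    have h2 : ∫ s in t₁..t₂, (1 + 3*a^2) * R * (s^2)⁻¹ =
        (-((1 + 3*a^2) * R * t₂⁻¹)) - (-((1 + 3*a^2) * R * t₁⁻¹)) := by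
      apply intervalIntegral.integral_eq_sub_of_hasDerivAt
        (f := fun s => -((1 + 3*a^2) * R * s⁻¹)) _ cs.intervalIntegrable
      intro s hs
      have : 1 ≤ s := hsub hs
      have h := ((hasDerivAt_inv (by linarith : s ≠ 0)).const_mul ((1 + 3*a^2) * R)).neg
      refine HasDerivAt.congr_deriv h (Eq.symm ?_)
      ring
    rw [h2]
    have : 0 ≤ (1 + 3*a^2) * R * t₂⁻¹ := by positivity
    linarith
  change ‖∫ s in t₁..t₂, G s‖ ≤ _
  have e : 2*Complex.I*x * (∫ s in t₁..t₂, G s) = G t₂ - G t₁ - ∫ s in t₁..t₂, Rm s := by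
    rw [← ftc]; ring
  have e2 := congrArg norm e
  rw [norm_mul, norm_mul, norm_mul, Complex.norm_I, Complex.norm_real, Real.norm_of_nonneg hx.le]
    at e2
  have e3 : ‖G t₂ - G t₁ - ∫ s in t₁..t₂, Rm s‖ ≤ R * t₁⁻¹ + R * t₁⁻¹ + (1 + 3*a^2) * R * t₁⁻¹ := by
    refine (norm_sub_le _ _).trans (add_le_add ((norm_sub_le _ _).trans (add_le_add ?_ (hGn _ ht1))) hIR)
    refine (hGn _ (ht1.trans ht12)).trans ?_
    gcongr
  rw [← e2] at e3
  norm_num at e3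
  have e4 : x * ‖∫ s in t₁..t₂, G s‖ ≤ (3 + 3*a^2) * R * t₁⁻¹ := by
    have : 0 ≤ x * ‖∫ s in t₁..t₂, G s‖ := by positivity
    nlinarith
  rw [le_div_iff₀ (by positivity)]
  calc ‖∫ s in t₁..t₂, G s‖ * (x*t₁) = (x * ‖∫ s in t₁..t₂, G s‖) * t₁ := by ring
    _ ≤ (3 + 3*a^2) * R * t₁⁻¹ * t₁ := by gcongr
    _ = (3 + 3*a^2) * R := by field_simp
    _ = _ := by rw [hR]; ring

lemma L2bound (β : ℝ) (hβ : 1 < β) (t : ℝ) (ht : 1 ≤ t) :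
    eLpNorm (fun ξ : ℝ => |ξ| ^ (-β)) 2 (volume.restrict {ξ : ℝ | 1 / t ≤ ξ^2 ∧ ξ^2 ≤ 1})
      ≤ ENNReal.ofReal (Real.sqrt 2 * t ^ (β/2 - 1/4)) := by
  have ht0 : 0 < t := by linarith
  set r : ℝ := t ^ (-(1/2) : ℝ) with hr
  have hr0 : 0 < r := by positivity
  have hr2 : r^2 = 1/t := by
    rw [hr, ← Real.rpow_natCast, ← Real.rpow_mul ht0.le]
    norm_num
    exact Real.rpow_neg_one t
  have hmeas : Measurable (fun ξ : ℝ => ENNReal.ofReal (|ξ| ^ (-(2*β)))) := by fun_prop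
  have hI : ∫⁻ ξ in Set.Ici r, ENNReal.ofReal (|ξ| ^ (-(2*β))) ≤ ENNReal.ofReal (r ^ (1 - 2*β)) := by
    rw [setLIntegral_congr Ioi_ae_eq_Ici.symm]
    have h1 : ∫⁻ ξ in Set.Ioi r, ENNReal.ofReal (|ξ| ^ (-(2*β))) =
        ∫⁻ ξ in Set.Ioi r, ENNReal.ofReal (ξ ^ (-(2*β))) := by
      apply setLIntegral_congr_fun measurableSet_Ioi
      intro ξ hξ
      simp only
      rw [abs_of_pos (hr0.trans hξ)]
    rw [h1, ← ofReal_integral_eq_lintegral_ofReal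
      (integrableOn_Ioi_rpow_of_lt (by linarith) hr0)
      ((ae_restrict_mem measurableSet_Ioi).mono fun ξ hξ => by
        have : 0 < ξ := hr0.trans hξ
        positivity)]
    rw [integral_Ioi_rpow_of_lt (by linarith) hr0]
    apply ENNReal.ofReal_le_ofReal
    have e : -(2*β) + 1 = 1 - 2*β := by ring
    rw [e, ← neg_div_neg_eq, neg_neg]
    apply div_le_self (by positivity)
    linarith
  have hI2 : ∫⁻ ξ in Set.Iic (-r), ENNReal.ofReal (|ξ| ^ (-(2*β))) ≤
      ENNReal.ofReal (r ^ (1 - 2*β)) := by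
    have := (Measure.measurePreserving_neg (volume : Measure ℝ)).setLIntegral_comp_preimage
      (s := Set.Ici r) measurableSet_Ici hmeas
    simp only [Set.neg_preimage, Set.neg_Ici, abs_neg] at this
    rw [this]; exact hI
  rw [eLpNorm_eq_lintegral_rpow_enorm_toReal (by norm_num) (by norm_num)]
  have hint : ∫⁻ ξ in {ξ : ℝ | 1 / t ≤ ξ^2 ∧ ξ^2 ≤ 1}, ‖|ξ| ^ (-β)‖ₑ ^ (2:ENNReal).toReal
      ≤ ENNReal.ofReal (2 * r ^ (1 - 2*β)) := by
    calc _ = ∫⁻ ξ in {ξ : ℝ | 1 / t ≤ ξ^2 ∧ ξ^2 ≤ 1}, ENNReal.ofReal (|ξ| ^ (-(2*β))) := by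
          apply lintegral_congr
          intro ξ
          rw [Real.enorm_of_nonneg (by positivity), ENNReal.ofReal_rpow_of_nonneg (by positivity)
            (by simp), ← Real.rpow_mul (abs_nonneg _)]
          congr 2
          simp; ring
      _ ≤ ∫⁻ ξ in Set.Iic (-r) ∪ Set.Ici r, ENNReal.ofReal (|ξ| ^ (-(2*β))) := by
          apply lintegral_mono_set
          intro ξ hξ
          have h : r^2 ≤ ξ^2 := by rw [hr2]; exact hξ.1
          have h2 : r ≤ |ξ| := by rw [← abs_of_pos hr0]; exact sq_le_sq.1 h
          rcases le_abs.1 h2 with h | h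
          · right; exact h
          · left; simp only [Set.mem_Iic]; linarith
      _ ≤ _ := lintegral_union_le _ _ _
      _ ≤ _ := add_le_add hI2 hI
      _ = _ := by rw [← ENNReal.ofReal_add (by positivity) (by positivity)]; ring_nf
  calc _ ≤ (ENNReal.ofReal (2 * r ^ (1 - 2*β))) ^ (1 / (2:ENNReal).toReal) := by
        gcongr
    _ = _ := by
        rw [ENNReal.ofReal_rpow_of_nonneg (by positivity) (by simp)]
        congr 1
        rw [Real.mul_rpow (by positivity) (by positivity), hr, ← Real.rpow_mul ht0.le,
          ← Real.rpow_mul ht0.le, Real.sqrt_eq_rpow]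
        simp only [ENNReal.toReal_ofNat]
        congr 2
        ring

/-- **L² bound on the Duhamel term in the intermediate-frequency region `{1/t₁ ≤ ξ² ≤ 1}`.** For `a > 0`,
`0 ≤ γ < 1/2`, `δ > 0` with `γ + δ < 1/2`, there is `C > 0` depending only on
`a, γ, δ` such that: if `F` is measurable with a.e. coupled `C¹` Fourier modes solving
`F_t(t,ξ) = −iξ² F(t,ξ) + ia² t^{−1−2ia²} conj(F(t,−ξ))`, and
`|ξ|^γ |F(1,ξ)| ≤ M` for a.e. `|ξ| ≤ 1`, then for all `1 ≤ t₁ ≤ t₂` the function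
`A_{t₁,t₂}(ξ) = ∫_{t₁}^{t₂} e^{isξ²} conj(F(s,−ξ)) s^{−1−2ia²} ds` satisfies
`‖A_{t₁,t₂}‖_{L²(intermediate-frequency region `{1/t₁ ≤ ξ² ≤ 1}`)} ≤ C t₁^{−1/4+(γ+δ)/2} M`. -/
theorem stmt_9
    (a γ δ : ℝ) (ha : 0 < a) (hγ : 0 ≤ γ) (hγhalf : γ < 1/2) (hδ : 0 < δ)
    (hγδ : γ + δ < 1/2) :
    ∃ C : ℝ, 0 < C ∧ ∀ (F : ℝ → ℝ → ℂ) (M : ℝ),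
      Measurable (fun p : ℝ × ℝ => F p.1 p.2) →
      (∀ᵐ ξ : ℝ, ∀ t ∈ Set.Ici (1:ℝ),
        HasDerivWithinAt (fun s => F s ξ)
          (-(Complex.I * (ξ:ℂ)^2) * F t ξ
            + Complex.I * (a:ℂ)^2 * (t:ℂ) ^ ((-1:ℂ) - 2*Complex.I*(a:ℂ)^2)
                * (starRingEnd ℂ) (F t (-ξ))) (Set.Ici 1) t ∧
        HasDerivWithinAt (fun s => F s (-ξ))
          (-(Complex.I * (ξ:ℂ)^2) * F t (-ξ)
            + Complex.I * (a:ℂ)^2 * (t:ℂ) ^ ((-1:ℂ) - 2*Complex.I*(a:ℂ)^2)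
                * (starRingEnd ℂ) (F t ξ)) (Set.Ici 1) t) →
      (∀ᵐ ξ : ℝ, |ξ| ≤ 1 → |ξ| ^ γ * ‖F 1 ξ‖ ≤ M) →
      ∀ t₁ t₂ : ℝ, 1 ≤ t₁ → t₁ ≤ t₂ →
        eLpNorm (fun ξ : ℝ => ∫ s in t₁..t₂,
            Complex.exp (Complex.I * (s:ℂ) * (ξ:ℂ)^2) * (starRingEnd ℂ) (F s (-ξ))
              * (s:ℂ) ^ ((-1:ℂ) - 2*Complex.I*(a:ℂ)^2))
          2 (volume.restrict {ξ : ℝ | 1 / t₁ ≤ ξ^2 ∧ ξ^2 ≤ 1})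
        ≤ ENNReal.ofReal (C * t₁ ^ (-1/4 + (γ + δ)/2) * M) := by
  obtain ⟨C, hC, hpt⟩ := ptwise a δ ha hδ
  refine ⟨C * Real.sqrt 2, by positivity, ?_⟩
  intro F M _ hode hM t₁ t₂ ht1 ht12
  have ht0 : 0 < t₁ := by linarith
  have hneg := (Measure.measurePreserving_neg (volume : Measure ℝ)).quasiMeasurePreserving.ae hM
  have hM0 : 0 ≤ M := by
    by_contra hlt
    push Not at hlt
    have hz : volume (Set.Icc (0:ℝ) 1) = 0 := by
      refine measure_mono_null ?_ hM
      intro ξ hξ hh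
      have := hh (by rw [abs_of_nonneg hξ.1]; exact hξ.2)
      have : 0 ≤ |ξ| ^ γ * ‖F 1 ξ‖ := by positivity
      linarith
    simp at hz
  set β : ℝ := γ + δ + 2 with hβ
  have hpw : ∀ᵐ (ξ : ℝ) ∂(volume.restrict {ξ : ℝ | 1 / t₁ ≤ ξ^2 ∧ ξ^2 ≤ 1}),
      ‖∫ s in t₁..t₂,
            Complex.exp (Complex.I * (s:ℂ) * (ξ:ℂ)^2) * (starRingEnd ℂ) (F s (-ξ))
              * (s:ℂ) ^ ((-1:ℂ) - 2*Complex.I*(a:ℂ)^2)‖ ≤ ‖(C * M / t₁) • |ξ| ^ (-β)‖ := by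
    have hms : MeasurableSet {ξ : ℝ | 1 / t₁ ≤ ξ^2 ∧ ξ^2 ≤ 1} :=
      MeasurableSet.inter (s₁ := {ξ : ℝ | 1 / t₁ ≤ ξ^2}) (s₂ := {ξ : ℝ | ξ^2 ≤ 1})
        (measurableSet_le measurable_const (by fun_prop))
        (measurableSet_le (by fun_prop) measurable_const)
    filter_upwards [ae_restrict_mem hms, ae_restrict_of_ae hode, ae_restrict_of_ae hM,
      ae_restrict_of_ae hneg] with ξ hξ hF hM1 hM2
    have hx0 : 0 < ξ^2 := lt_of_lt_of_le (by positivity) hξ.1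
    have hξ0 : 0 < |ξ| := abs_pos.2 (by rintro rfl; simp at hx0)
    have hξ1 : |ξ| ≤ 1 := by
      have := hξ.2
      rwa [sq_le_one_iff_abs_le_one] at this
    have hpow : 0 < |ξ| ^ γ := by positivity
    have b1 : ‖F 1 ξ‖ ≤ |ξ| ^ (-γ) * M := by
      rw [Real.rpow_neg hξ0.le, ← div_eq_inv_mul, le_div_iff₀ hpow]
      linarith [hM1 hξ1]
    have b2 : ‖F 1 (-ξ)‖ ≤ |ξ| ^ (-γ) * M := by
      rw [Real.rpow_neg hξ0.le, ← div_eq_inv_mul, le_div_iff₀ hpow]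
      have := hM2 (by rwa [abs_neg])
      rw [abs_neg] at this
      linarith
    have h := hpt (ξ^2) (fun s => F s ξ) (fun s => F s (-ξ)) hx0 hξ.2
      (fun t ht => by have := (hF t ht).1; push_cast; exact this)
      (fun t ht => by have := (hF t ht).2; push_cast; exact this)
      (|ξ| ^ (-γ) * M) b1 b2 t₁ t₂ ht1 ht12
    push_cast at h
    refine h.trans ?_
    rw [smul_eq_mul, Real.norm_of_nonneg (by positivity)]
    apply le_of_eq
    have e1 : (ξ^2) ^ (-(δ/2)) = |ξ| ^ (-δ) := by
      rw [← sq_abs, ← Real.rpow_natCast, ← Real.rpow_mul hξ0.le]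
      congr 1; push_cast; ring
    have e2 : |ξ| ^ (-β) = |ξ| ^ (-γ) * |ξ| ^ (-δ) * (ξ^2)⁻¹ := by
      rw [← sq_abs ξ, ← Real.rpow_natCast, ← Real.rpow_neg hξ0.le, ← Real.rpow_add hξ0,
        ← Real.rpow_add hξ0]
      congr 1; rw [hβ]; push_cast; ring
    rw [e1, e2]
    field_simp
  refine (eLpNorm_mono_ae hpw).trans ?_
  change eLpNorm ((C * M / t₁) • (fun ξ : ℝ => |ξ| ^ (-β))) 2 _ ≤ _
  rw [eLpNorm_const_smul]
  refine (mul_le_mul_right (L2bound β (by linarith) t₁ ht1) _).trans ?_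
  rw [Real.enorm_of_nonneg (by positivity), ← ENNReal.ofReal_mul (by positivity)]
  apply le_of_eq
  congr 1
  have e : t₁ ^ (β/2 - 1/4) = t₁ * t₁ ^ (-1/4 + (γ + δ)/2) := by
    nth_rewrite 2 [← Real.rpow_one t₁]
    rw [← Real.rpow_add ht0]
    congr 1; rw [hβ]; ring
  rw [e]
  field_simp
end
end

section
/- Let a > 0, 0 ≤ γ < 1/2 and δ > 0 with γ + δ < 1/2. Let F : [1,∞) × ℝ → ℂ be measurable, such that for almost every ξ ∈ ℝ the functions t ↦ F(t,ξ) and t ↦ F(t,−ξ) are C¹ and satisfy F_t(t,ξ) = −i ξ² F(t,ξ) + i a² t^{−1−2ia²} conj(F(t,−ξ)). Assume M_γ := ess sup_{|ξ| ≤ 1} |ξ|^{γ} |F(1,ξ)| < ∞. Then there is a constant C, depending only on a, γ, δ, such that for all 1 ≤ t₁ ≤ t₂, the function A_{t₁,t₂}(ξ) = ∫_{t₁}^{t₂} e^{i s ξ²} conj(F(s,−ξ)) s^{−1−2ia²} ds satisfies ‖A_{t₁,t₂}‖_{L²({ξ² ≤ 1/t₁})} ≤ C t₁^{−1/4 + (γ+δ)/2}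 M_γ. -/
open MeasureTheory

noncomputable section


lemma gron_s10 {τ₀ τ : ℝ} {N N' φ φ' : ℝ → ℝ} (h : τ₀ ≤ τ)
    (hN : ∀ s ∈ Set.Icc τ₀ τ, HasDerivWithinAt N (N' s) (Set.Icc τ₀ τ) s)
    (hφ : ∀ s ∈ Set.Icc τ₀ τ, HasDerivWithinAt φ (φ' s) (Set.Icc τ₀ τ) s)
    (hle : ∀ s ∈ Set.Icc τ₀ τ, N' s ≤ φ' s * N s) :
    N τ * Real.exp (-φ τ) ≤ N τ₀ * Real.exp (-φ τ₀) := by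
  have key : AntitoneOn (fun s => N s * Real.exp (-φ s)) (Set.Icc τ₀ τ) := by
    have hd : ∀ s ∈ Set.Icc τ₀ τ, HasDerivWithinAt (fun s => N s * Real.exp (-φ s))
        (N' s * Real.exp (-φ s) + N s * (Real.exp (-φ s) * (-φ' s))) (Set.Icc τ₀ τ) s := by
      intro s hs
      exact (hN s hs).mul ((hφ s hs).neg.exp)
    refine antitoneOn_of_hasDerivWithinAt_nonpos (convex_Icc _ _)
      (fun s hs => (hd s hs).continuousWithinAt)
      (fun s hs => (hd s (interior_subset hs)).mono interior_subset) ?_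
    intro s hs
    have h1 := hle s (interior_subset hs)
    have h2 := Real.exp_pos (-φ s)
    nlinarith
  exact key (Set.left_mem_Icc.2 h) (Set.right_mem_Icc.2 h) h

lemma region1 {b σ τ₀ τ : ℝ} (hb : 0 < b) (hσ : 0 < σ) (hσ1 : σ < 1) (h0 : 0 < τ₀) (hτ1 : τ₀ ≤ 1)
    (h : τ₀ ≤ τ) (hT : τ ≤ 2 * b + 1) {x y : ℝ → ℝ}
    (hx : ∀ s ∈ Set.Ici τ₀, HasDerivWithinAt x (y s) (Set.Ici τ₀) s)
    (hy : ∀ s ∈ Set.Ici τ₀, HasDerivWithinAt y ((b / s - 1) * x s) (Set.Ici τ₀) s) :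
    x τ ^ 2 + y τ ^ 2 ≤ (2 * b + 1) ^ (2 * σ) *
      Real.exp ((2*b+1) ^ (1 - σ) / (1 - σ) + b * (2*b+1) ^ σ / σ + (2*b+1) ^ (σ + 1) / (σ + 1))
      * τ₀ ^ (-2 * σ) * (x τ₀ ^ 2 + y τ₀ ^ 2) := by
  set φ : ℝ → ℝ := fun s => s ^ (1 - σ) / (1 - σ) + b * s ^ σ / σ + s ^ (σ + 1) / (σ + 1) with hφ
  set N : ℝ → ℝ := fun s => s ^ (-2*σ) * x s ^ 2 + y s ^ 2 with hN
  have hτ0 : 0 < τ := by linarith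
  have hsub : Set.Icc τ₀ τ ⊆ Set.Ici τ₀ := Set.Icc_subset_Ici_self
  have g := @gron_s10 τ₀ τ N
    (fun s => ((-2*σ) * s ^ (-2*σ-1)) * x s ^ 2 + s ^ (-2*σ) * (2 * x s * y s)
      + 2 * y s * ((b / s - 1) * x s)) φ
    (fun s => s ^ (-σ) + b * s ^ (σ-1) + s ^ σ) h ?_ ?_ ?_
  · have e1 : N τ ≤ N τ₀ * Real.exp (φ τ) := by
      have h1 : N τ = (N τ * Real.exp (-φ τ)) * Real.exp (φ τ) := by
        rw [mul_assoc, ← Real.exp_add]; simp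
      rw [h1]
      refine mul_le_mul_of_nonneg_right (g.trans ?_) (Real.exp_pos _).le
      have : Real.exp (-φ τ₀) ≤ 1 := by
        rw [Real.exp_le_one_iff]
        have : 0 ≤ φ τ₀ := by
          have : 0 < 1 - σ := by linarith
          simp only [hφ]; positivity
        linarith
      have : 0 ≤ N τ₀ := by simp only [hN]; positivity
      nlinarith
    have e2 : φ τ ≤ φ (2*b+1) := by
      simp only [hφ]
      have : 0 < 1 - σ := by linarith
      gcongr
    have e3 : N τ₀ ≤ τ₀ ^ (-2*σ) * (x τ₀ ^ 2 + y τ₀ ^ 2) := by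
      have : 1 ≤ τ₀ ^ (-2*σ) := Real.one_le_rpow_of_pos_of_le_one_of_nonpos h0 hτ1 (by linarith)
      simp only [hN]
      nlinarith [sq_nonneg (y τ₀)]
    have e4 : x τ ^ 2 + y τ ^ 2 ≤ (2 * b + 1) ^ (2 * σ) * N τ := by
      have a1 : 1 ≤ (2 * b + 1) ^ (2 * σ) := Real.one_le_rpow (by linarith) (by linarith)
      have a2 : 1 ≤ (2 * b + 1) ^ (2 * σ) * τ ^ (-2*σ) := by
        have : τ ^ (2 * σ) ≤ (2 * b + 1) ^ (2 * σ) := by gcongr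
        calc (1:ℝ) = τ ^ (2 * σ) * τ ^ (-2*σ) := by rw [← Real.rpow_add hτ0]; simp
          _ ≤ _ := by gcongr
      simp only [hN]
      nlinarith [sq_nonneg (y τ), sq_nonneg (x τ)]
    calc x τ ^ 2 + y τ ^ 2 ≤ (2 * b + 1) ^ (2 * σ) * N τ := e4
      _ ≤ (2 * b + 1) ^ (2 * σ) * ((τ₀ ^ (-2*σ) * (x τ₀ ^ 2 + y τ₀ ^ 2)) * Real.exp (φ (2*b+1))) := by
        gcongr
        refine e1.trans ?_
        gcongr
      _ = _ := by simp only [hφ]; ring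
  · intro s hs
    have hs0 : 0 < s := lt_of_lt_of_le h0 hs.1
    have d1 := (Real.hasDerivAt_rpow_const (p := -2*σ) (Or.inl hs0.ne')).hasDerivWithinAt (s := Set.Icc τ₀ τ)
    have d2 := ((hx s hs.1).mono hsub).pow 2
    have d3 := ((hy s hs.1).mono hsub).pow 2
    refine ((d1.mul d2).add d3).congr_deriv ?_
    simp
  · intro s hs
    have hs0 : 0 < s := lt_of_lt_of_le h0 hs.1
    have d1 := (Real.hasDerivAt_rpow_const (p := 1-σ) (Or.inl hs0.ne')).hasDerivWithinAt (s := Set.Icc τ₀ τ)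
    have d2 := (Real.hasDerivAt_rpow_const (p := σ) (Or.inl hs0.ne')).hasDerivWithinAt (s := Set.Icc τ₀ τ)
    have d3 := (Real.hasDerivAt_rpow_const (p := σ+1) (Or.inl hs0.ne')).hasDerivWithinAt (s := Set.Icc τ₀ τ)
    refine (((d1.div_const (1-σ)).add ((d2.const_mul b).div_const σ)).add (d3.div_const (σ+1))).congr_deriv ?_
    have : 1 - σ ≠ 0 := by linarith
    have : σ + 1 ≠ 0 := by linarith
    have e1 : 1 - σ - 1 = -σ := by ring
    have e2 : σ + 1 - 1 = σ := by ring
    rw [e1, e2]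
    field_simp
  · intro s hs
    have hs0 : 0 < s := lt_of_lt_of_le h0 hs.1
    simp only [hN]
    set X := s ^ (-σ) * x s with hX
    have p1 : s ^ (-2*σ) = s ^ (-σ) * s ^ (-σ) := by rw [← Real.rpow_add hs0]; ring_nf
    have p2 : s ^ σ * s ^ (-σ) = 1 := by rw [← Real.rpow_add hs0]; simp
    have p3 : s ^ (σ-1) = s ^ σ / s := by rw [Real.rpow_sub hs0, Real.rpow_one]
    have q0 : 0 < s ^ (-2*σ-1) := Real.rpow_pos_of_pos hs0 _
    have q1 : 0 < s ^ (-σ) := Real.rpow_pos_of_pos hs0 _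
    have q2 : 0 < s ^ σ := Real.rpow_pos_of_pos hs0 _
    have hxX : x s = s ^ σ * X := by rw [hX, ← mul_assoc, p2, one_mul]
    have r0 : ((-2*σ) * s ^ (-2*σ-1)) * x s ^ 2 ≤ 0 := by
      have : 0 ≤ σ * s ^ (-2*σ-1) * x s ^ 2 := by positivity
      linarith
    have r1 : s ^ (-2*σ) * (2 * x s * y s) = s ^ (-σ) * (2 * (X * y s)) := by
      rw [p1, hX]; ring
    have r2 : 2 * y s * ((b / s - 1) * x s) = (b * (s ^ σ / s)) * (2 * (X * y s)) - s ^ σ * (2 * (X * y s)) := by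
      rw [hxX]; ring
    have r3 : s ^ (-2*σ) * x s ^ 2 = X ^ 2 := by rw [p1, hX]; ring
    rw [r1, r2, r3, p3]
    have c1 : 2 * (X * y s) ≤ X ^ 2 + y s ^ 2 := by nlinarith [sq_nonneg (X - y s)]
    have c2 : -(2 * (X * y s)) ≤ X ^ 2 + y s ^ 2 := by nlinarith [sq_nonneg (X + y s)]
    have q3 : 0 ≤ b * (s ^ σ / s) := by positivity
    nlinarith [mul_le_mul_of_nonneg_left c1 q1.le, mul_le_mul_of_nonneg_left c1 q3,
      mul_le_mul_of_nonneg_left c2 q2.le]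

lemma region2 {b T τ₀ τ : ℝ} (hb : 0 < b) (h0 : τ₀ ≤ T) (hT : T = 2 * b + 1)
    (h : T ≤ τ) {x y : ℝ → ℝ}
    (hx : ∀ s ∈ Set.Ici τ₀, HasDerivWithinAt x (y s) (Set.Ici τ₀) s)
    (hy : ∀ s ∈ Set.Ici τ₀, HasDerivWithinAt y ((b / s - 1) * x s) (Set.Ici τ₀) s) :
    x τ ^ 2 + y τ ^ 2 ≤ 2 * Real.exp 1 * (x T ^ 2 + y T ^ 2) := by
  set N : ℝ → ℝ := fun s => (1 - b * s⁻¹) * x s ^ 2 + y s ^ 2 with hN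
  have hTpos : 0 < T := by linarith
  have hτ0 : 0 < τ := by linarith
  have hsub : Set.Icc T τ ⊆ Set.Ici τ₀ := fun s hs => h0.trans hs.1
  have hinv : ∀ s, T ≤ s → b * s⁻¹ ≤ 1/2 ∧ 0 ≤ b * s⁻¹ := by
    intro s hs
    have : 0 < s := by linarith
    refine ⟨?_, by positivity⟩
    rw [← div_eq_mul_inv, div_le_div_iff₀ this two_pos]; linarith
  have g := @gron_s10 T τ N
    (fun s => b * (s^2)⁻¹ * x s ^ 2)
    (fun s => - (2 * b * s⁻¹))
    (fun s => 2 * b * (s^2)⁻¹) h ?_ ?_ ?_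
  · simp only [neg_neg] at g
    have a1 := hinv T le_rfl
    have a2 := hinv τ h
    have e1 : x τ ^ 2 + y τ ^ 2 ≤ 2 * N τ := by
      simp only [hN]; nlinarith [sq_nonneg (x τ), sq_nonneg (y τ)]
    have e2 : N T ≤ x T ^ 2 + y T ^ 2 := by
      simp only [hN]; nlinarith [sq_nonneg (x T), sq_nonneg (y T)]
    have e3 : 1 ≤ Real.exp (2 * b * τ⁻¹) := Real.one_le_exp (by linarith [a2.2])
    have e4 : Real.exp (2 * b * T⁻¹) ≤ Real.exp 1 := Real.exp_le_exp.2 (by linarith [a1.1])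
    have e5 : 0 ≤ N τ := by nlinarith [sq_nonneg (x τ), sq_nonneg (y τ)]
    have e6 : N T * Real.exp (2 * b * T⁻¹) ≤ (x T ^ 2 + y T ^ 2) * Real.exp 1 := by gcongr
    nlinarith
  · intro s hs
    have hs0 : 0 < s := lt_of_lt_of_le hTpos hs.1
    have d1 := (((hasDerivAt_inv hs0.ne').const_mul b).const_sub 1).hasDerivWithinAt (s := Set.Icc T τ)
    have d2 := ((hx s (hsub hs)).mono hsub).pow 2
    have d3 := ((hy s (hsub hs)).mono hsub).pow 2
    refine ((d1.mul d2).add d3).congr_deriv ?_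
    simp
    field_simp
    ring
  · intro s hs
    have hs0 : 0 < s := lt_of_lt_of_le hTpos hs.1
    have d1 := (((hasDerivAt_inv hs0.ne').const_mul (2*b)).neg).hasDerivWithinAt (s := Set.Icc T τ)
    refine d1.congr_deriv ?_
    simp
  · intro s hs
    have hs0 : 0 < s := lt_of_lt_of_le hTpos hs.1
    have a1 := hinv s hs.1
    simp only [hN]
    have : x s ^ 2 ≤ 2 * ((1 - b * s⁻¹) * x s ^ 2 + y s ^ 2) := by
      nlinarith [sq_nonneg (x s), sq_nonneg (y s)]
    have q : 0 ≤ b * (s^2)⁻¹ := by positivity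
    nlinarith [mul_le_mul_of_nonneg_left this q]

lemma core {b σ : ℝ} (hb : 0 < b) (hσ : 0 < σ) (hσ1 : σ < 1) :
    ∃ K : ℝ, 0 < K ∧ ∀ (τ₀ : ℝ) (x y : ℝ → ℝ), 0 < τ₀ → τ₀ ≤ 1 →
    (∀ s ∈ Set.Ici τ₀, HasDerivWithinAt x (y s) (Set.Ici τ₀) s) →
    (∀ s ∈ Set.Ici τ₀, HasDerivWithinAt y ((b / s - 1) * x s) (Set.Ici τ₀) s) →
    ∀ τ, τ₀ ≤ τ → x τ ^ 2 + y τ ^ 2 ≤ K * τ₀ ^ (-2 * σ) * (x τ₀ ^ 2 + y τ₀ ^ 2) := by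
  set K₁ := (2 * b + 1) ^ (2 * σ) *
      Real.exp ((2*b+1) ^ (1 - σ) / (1 - σ) + b * (2*b+1) ^ σ / σ + (2*b+1) ^ (σ + 1) / (σ + 1)) with hK
  have hK1 : 0 < K₁ := by positivity
  refine ⟨2 * Real.exp 1 * K₁, by positivity, ?_⟩
  intro τ₀ x y h0 h1 hx hy τ h
  have he : 1 ≤ Real.exp 1 := Real.one_le_exp (by norm_num)
  by_cases hT : τ ≤ 2 * b + 1
  · have := region1 hb hσ hσ1 h0 h1 h hT hx hy
    rw [← hK] at this
    refine this.trans ?_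
    have : K₁ ≤ 2 * Real.exp 1 * K₁ := by nlinarith
    gcongr
  · have r1 := region1 hb hσ hσ1 h0 h1 (by linarith : τ₀ ≤ 2*b+1) le_rfl hx hy
    have r2 := region2 hb (by linarith : τ₀ ≤ 2*b+1) rfl (not_le.1 hT).le hx hy
    rw [← hK] at r1
    refine r2.trans ?_
    calc _ ≤ 2 * Real.exp 1 * (K₁ * τ₀ ^ (-2 * σ) * (x τ₀ ^ 2 + y τ₀ ^ 2)) := by gcongr
      _ = _ := by ring

lemma scalar_bound {a σ : ℝ} (ha : 0 < a) (hσ : 0 < σ) (hσ1 : σ < 1) :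
    ∃ K : ℝ, 0 < K ∧ ∀ (ξ : ℝ) (w : ℝ → ℂ), ξ ≠ 0 → |ξ| ≤ 1 →
    (∀ t ∈ Set.Ici (1:ℝ), HasDerivWithinAt w
      (-(Complex.I * (ξ:ℂ)^2) * w t
            + Complex.I * (a:ℂ)^2 * (t:ℂ) ^ ((-1:ℂ) - 2*Complex.I*(a:ℂ)^2)
                * (starRingEnd ℂ) (w t)) (Set.Ici 1) t) →
    ∀ t, 1 ≤ t → ‖w t‖ ≤ K * |ξ| ^ (-(2 * σ)) * ‖w 1‖ := by
  obtain ⟨K, hK, hcore⟩ := core (b := 2 * a ^ 2) (by positivity) hσ hσ1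
  refine ⟨Real.sqrt K, Real.sqrt_pos.2 hK, ?_⟩
  intro ξ w hξ hξ1 hw t ht
  have hξ2 : 0 < ξ ^ 2 := by positivity
  have hξ21 : ξ ^ 2 ≤ 1 := by rw [← sq_abs]; exact pow_le_one₀ (abs_nonneg _) hξ1
  set H : ℝ → ℂ := fun t => (t:ℂ) ^ (Complex.I * (a:ℂ)^2) * w t with hH
  have hnorm : ∀ t : ℝ, 1 ≤ t → ‖(t:ℂ) ^ (Complex.I * (a:ℂ)^2)‖ = 1 := by
    intro t ht
    rw [Complex.norm_cpow_eq_rpow_re_of_pos (by linarith)]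
    have : (Complex.I * (a:ℂ)^2).re = 0 := by simp [← Complex.ofReal_pow]
    rw [this, Real.rpow_zero]
  have hHn : ∀ t : ℝ, 1 ≤ t → (H t).re ^ 2 + (H t).im ^ 2 = ‖w t‖ ^ 2 := by
    intro t ht
    have : ‖H t‖ = ‖w t‖ := by simp only [hH, norm_mul, hnorm t ht, one_mul]
    rw [← this, Complex.sq_norm, Complex.normSq_apply]; ring
  have hHd : ∀ t ∈ Set.Ici (1:ℝ), HasDerivWithinAt H
      (Complex.I * ((2 * a ^ 2 / t * (H t).re : ℝ) : ℂ) - Complex.I * ((ξ^2 : ℝ) : ℂ) * H t) (Set.Ici 1) t := by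
    intro t ht
    have ht1 : (1:ℝ) ≤ t := ht
    have ht0 : (t:ℂ) ≠ 0 := by exact_mod_cast (by linarith : t ≠ 0)
    have hr : Complex.I * (a:ℂ)^2 ≠ 0 := by simp [ha.ne']
    have d1 := (hasDerivAt_ofReal_cpow_const (by linarith : t ≠ 0) hr).hasDerivWithinAt (s := Set.Ici 1)
    refine (d1.mul (hw t ht)).congr_deriv ?_
    have i1 : (t:ℂ) ^ (Complex.I * (a:ℂ)^2 - 1) = (t:ℂ) ^ (Complex.I * (a:ℂ)^2) / t := by
      rw [Complex.cpow_sub _ _ ht0, Complex.cpow_one]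
    set c := (t:ℂ) ^ (Complex.I * (a:ℂ)^2) with hc
    have i2 : c * (starRingEnd ℂ) c = 1 := by
      rw [Complex.mul_conj, Complex.normSq_eq_norm_sq, hnorm t ht1]; simp
    have i3 : c * (t:ℂ) ^ (-(Complex.I * (a:ℂ)^2)) = 1 := by
      rw [hc, ← Complex.cpow_add _ _ ht0]; simp
    have hc0 : c ≠ 0 := left_ne_zero_of_mul_eq_one i3
    have i4 : (starRingEnd ℂ) c = (t:ℂ) ^ (-(Complex.I * (a:ℂ)^2)) :=
      mul_left_cancel₀ hc0 (i2.trans i3.symm)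
    have i5 : c * (t:ℂ) ^ ((-1:ℂ) - 2*Complex.I*(a:ℂ)^2) = (starRingEnd ℂ) c / t := by
      rw [i4, hc, ← Complex.cpow_add _ _ ht0, div_eq_mul_inv, ← Complex.cpow_neg_one,
        ← Complex.cpow_add _ _ ht0]
      congr 1; ring
    have i6 : ((H t).re : ℂ) = (c * w t + (starRingEnd ℂ) c * (starRingEnd ℂ) (w t)) / 2 := by
      rw [Complex.re_eq_add_conj]; simp only [hH, map_mul, hc]
    push_cast
    rw [i1, i6]
    have : H t = c * w t := rfl
    rw [this]
    linear_combination (Complex.I * (a:ℂ)^2 * (starRingEnd ℂ) (w t)) * i5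
  have hmaps : Set.MapsTo (fun τ : ℝ => τ / ξ ^ 2) (Set.Ici (ξ^2)) (Set.Ici 1) := by
    intro τ hτ
    exact (one_le_div hξ2).2 hτ
  have hcomp : ∀ τ ∈ Set.Ici (ξ^2), HasDerivWithinAt (fun τ : ℝ => H (τ / ξ^2))
      ((1 / ξ ^ 2 : ℝ) • (Complex.I * ((2 * a ^ 2 / (τ / ξ^2) * (H (τ / ξ^2)).re : ℝ) : ℂ)
        - Complex.I * ((ξ^2 : ℝ) : ℂ) * H (τ / ξ^2))) (Set.Ici (ξ^2)) τ := by
    intro τ hτ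
    exact (hHd _ (hmaps hτ)).scomp τ ((hasDerivAt_id τ).div_const (ξ^2)).hasDerivWithinAt hmaps
  have h1 := hcore (ξ^2) (fun τ => (H (τ / ξ^2)).re) (fun τ => (H (τ / ξ^2)).im) hξ2 hξ21 ?_ ?_
    (t * ξ^2) (by nlinarith)
  · simp only [mul_div_cancel_right₀ _ hξ2.ne', div_self hξ2.ne'] at h1
    rw [hHn t ht, hHn 1 le_rfl] at h1
    have h2 : (ξ^2) ^ (-2 * σ) = (|ξ| ^ (-(2 * σ))) ^ 2 := by
      rw [← sq_abs, ← Real.rpow_natCast, ← Real.rpow_natCast, ← Real.rpow_mul (abs_nonneg _),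
        ← Real.rpow_mul (abs_nonneg _)]
      congr 1; push_cast; ring
    rw [h2] at h1
    refine le_of_sq_le_sq ?_ (by positivity)
    rw [mul_pow, mul_pow, Real.sq_sqrt hK.le]
    exact h1
  · intro τ hτ
    refine (Complex.reCLM.hasFDerivAt.comp_hasDerivWithinAt τ (hcomp τ hτ)).congr_deriv ?_
    simp [-Complex.ofReal_mul, -Complex.ofReal_div, -Complex.ofReal_pow]
    field_simp
  · intro τ hτ
    have hτ' : ξ^2 ≤ τ := hτ
    have hτ0 : τ ≠ 0 := by linarith
    refine (Complex.imCLM.hasFDerivAt.comp_hasDerivWithinAt τ (hcomp τ hτ)).congr_deriv ?_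
    simp [-Complex.ofReal_mul, -Complex.ofReal_div, -Complex.ofReal_pow]
    field_simp

lemma pair_bound {a σ : ℝ} (ha : 0 < a) (hσ : 0 < σ) (hσ1 : σ < 1) :
    ∃ K : ℝ, 0 < K ∧ ∀ (ξ : ℝ) (u v : ℝ → ℂ), ξ ≠ 0 → |ξ| ≤ 1 →
    (∀ t ∈ Set.Ici (1:ℝ), HasDerivWithinAt u
      (-(Complex.I * (ξ:ℂ)^2) * u t
            + Complex.I * (a:ℂ)^2 * (t:ℂ) ^ ((-1:ℂ) - 2*Complex.I*(a:ℂ)^2)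
                * (starRingEnd ℂ) (v t)) (Set.Ici 1) t) →
    (∀ t ∈ Set.Ici (1:ℝ), HasDerivWithinAt v
      (-(Complex.I * (ξ:ℂ)^2) * v t
            + Complex.I * (a:ℂ)^2 * (t:ℂ) ^ ((-1:ℂ) - 2*Complex.I*(a:ℂ)^2)
                * (starRingEnd ℂ) (u t)) (Set.Ici 1) t) →
    ∀ t, 1 ≤ t → ‖u t‖ ≤ K * |ξ| ^ (-(2 * σ)) * (‖u 1‖ + ‖v 1‖) := by
  obtain ⟨K, hK, hs⟩ := scalar_bound ha hσ hσ1
  refine ⟨K, hK, ?_⟩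
  intro ξ u v hξ hξ1 hu hv t ht
  have hp := hs ξ (fun s => u s + v s) hξ hξ1 (fun s hs => by
    refine ((hu s hs).add (hv s hs)).congr_deriv ?_
    rw [map_add]; ring) t ht
  have hq := hs ξ (fun s => Complex.I * (u s - v s)) hξ hξ1 (fun s hs => by
    refine (((hu s hs).sub (hv s hs)).const_mul Complex.I).congr_deriv ?_
    rw [map_mul, map_sub, Complex.conj_I]; ring) t ht
  simp only [norm_mul, Complex.norm_I, one_mul] at hq
  have e1 : ‖u t‖ ≤ (‖u t + v t‖ + ‖u t - v t‖) / 2 := by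
    have : (2:ℂ) * u t = (u t + v t) + (u t - v t) := by ring
    have h2 : ‖(2:ℂ) * u t‖ ≤ ‖u t + v t‖ + ‖u t - v t‖ := by rw [this]; exact norm_add_le _ _
    rw [norm_mul, Complex.norm_ofNat] at h2; linarith
  have e2 := norm_add_le (u 1) (v 1)
  have e3 := norm_sub_le (u 1) (v 1)
  have e4 : 0 ≤ K * |ξ| ^ (-(2 * σ)) := by positivity
  nlinarith [mul_le_mul_of_nonneg_left e2 e4, mul_le_mul_of_nonneg_left e3 e4]

lemma duhamel_bound {a : ℝ} (ha : 0 < a) (ξ : ℝ) (u v : ℝ → ℂ)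
    (hu : ∀ t ∈ Set.Ici (1:ℝ), HasDerivWithinAt u
      (-(Complex.I * (ξ:ℂ)^2) * u t
            + Complex.I * (a:ℂ)^2 * (t:ℂ) ^ ((-1:ℂ) - 2*Complex.I*(a:ℂ)^2)
                * (starRingEnd ℂ) (v t)) (Set.Ici 1) t)
    (hv : ContinuousOn v (Set.Ici 1)) {t₁ t₂ : ℝ} (h1 : 1 ≤ t₁) (h2 : t₁ ≤ t₂) :
    ‖∫ s in t₁..t₂, Complex.exp (Complex.I * (s:ℂ) * (ξ:ℂ)^2) * (starRingEnd ℂ) (v s)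
              * (s:ℂ) ^ ((-1:ℂ) - 2*Complex.I*(a:ℂ)^2)‖ ≤ (‖u t₁‖ + ‖u t₂‖) / a ^ 2 := by
  set f : ℝ → ℂ := fun s => (Complex.I * (a:ℂ)^2)⁻¹ * (Complex.exp (Complex.I * (s:ℂ) * (ξ:ℂ)^2) * u s) with hf
  have hsub : Set.Icc t₁ t₂ ⊆ Set.Ici 1 := fun s hs => h1.trans hs.1
  have ha' : (a:ℂ) ≠ 0 := by exact_mod_cast ha.ne'
  have hd : ∀ s ∈ Set.Ici (1:ℝ), HasDerivWithinAt f (Complex.exp (Complex.I * (s:ℂ) * (ξ:ℂ)^2) * (starRingEnd ℂ) (v s)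
              * (s:ℂ) ^ ((-1:ℂ) - 2*Complex.I*(a:ℂ)^2)) (Set.Ici 1) s := by
    intro s hs
    have d0 : HasDerivWithinAt (fun s : ℝ => Complex.I * (s:ℂ) * (ξ:ℂ)^2) (Complex.I * 1 * (ξ:ℂ)^2) (Set.Ici 1) s :=
      ((Complex.ofRealCLM.hasDerivAt.const_mul Complex.I).mul_const _).hasDerivWithinAt
    refine ((d0.cexp.mul (hu s hs)).const_mul _).congr_deriv ?_
    field_simp
    ring
  have hint : ∫ s in t₁..t₂, Complex.exp (Complex.I * (s:ℂ) * (ξ:ℂ)^2) * (starRingEnd ℂ) (v s)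
              * (s:ℂ) ^ ((-1:ℂ) - 2*Complex.I*(a:ℂ)^2) = f t₂ - f t₁ := by
    refine intervalIntegral.integral_eq_sub_of_hasDeriv_right_of_le h2
      (fun s hs => ((hd s (hsub hs)).mono hsub).continuousWithinAt) ?_ ?_
    · intro s hs
      exact (hd s (hsub (Set.Ioo_subset_Icc_self hs))).mono (fun r hr => by
        have := hs.1; have : s < r := hr; show 1 ≤ r; linarith)
    · apply ContinuousOn.intervalIntegrable
      rw [Set.uIcc_of_le h2]
      refine ContinuousOn.mul (ContinuousOn.mul (by fun_prop) ?_) ?_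
      · exact Complex.continuous_conj.comp_continuousOn (hv.mono hsub)
      · intro s hs
        have : (1:ℝ) ≤ s := hsub hs
        refine ContinuousAt.continuousWithinAt ?_
        exact Complex.continuousAt_ofReal_cpow_const _ _ (Or.inr (by linarith))
  rw [hint]
  have hn : ∀ s, ‖f s‖ = ‖u s‖ / a ^ 2 := by
    intro s
    have : ‖Complex.exp (Complex.I * (s:ℂ) * (ξ:ℂ)^2)‖ = 1 := by
      rw [Complex.norm_exp]
      have : (Complex.I * (s:ℂ) * (ξ:ℂ)^2).re = 0 := by simp [← Complex.ofReal_pow]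
      rw [this, Real.exp_zero]
    simp only [hf, norm_mul, norm_inv, norm_pow, this, Complex.norm_I, Complex.norm_real, Real.norm_eq_abs, abs_of_pos ha]
    field_simp
  calc _ ≤ ‖f t₂‖ + ‖f t₁‖ := norm_sub_le _ _
    _ = _ := by rw [hn, hn]; ring

lemma lint {r R : ℝ} (hr : r < 1) (hR : 0 < R) :
    ∫⁻ ξ in Set.Icc (-R) R, ENNReal.ofReal (|ξ| ^ (-r)) = ENNReal.ofReal (2 * (R ^ (1 - r) / (1 - r))) := by
  have i1 : IntervalIntegrable (fun x : ℝ => |x| ^ (-r)) volume 0 R := by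
    refine (intervalIntegral.intervalIntegrable_rpow' (r := -r) (by linarith)).congr ?_
    intro x hx
    rw [Set.uIoc_of_le hR.le] at hx
    simp [abs_of_pos hx.1]
  have v1 : ∫ x in (0:ℝ)..R, |x| ^ (-r) = R ^ (1 - r) / (1 - r) := by
    have : ∫ x in (0:ℝ)..R, |x| ^ (-r) = ∫ x in (0:ℝ)..R, x ^ (-r) := by
      refine intervalIntegral.integral_congr ?_
      intro x hx
      rw [Set.uIcc_of_le hR.le] at hx
      simp [abs_of_nonneg hx.1]
    rw [this, integral_rpow (Or.inl (by linarith)), Real.zero_rpow (by linarith)]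
    rw [sub_zero, neg_add_eq_sub]
  have i2 : IntervalIntegrable (fun x : ℝ => |x| ^ (-r)) volume (-R) 0 := by
    have := i1.comp_sub_left 0
    simp at this
    exact this.symm
  have v2 : ∫ x in (-R)..0, |x| ^ (-r) = R ^ (1 - r) / (1 - r) := by
    have := intervalIntegral.integral_comp_neg (a := 0) (b := R) (fun x : ℝ => |x| ^ (-r))
    simp only [abs_neg, neg_zero] at this
    rw [← this, v1]
  have i3 := i2.trans i1
  rw [← ofReal_integral_eq_lintegral_ofReal, MeasureTheory.integral_Icc_eq_integral_Ioc,
    ← intervalIntegral.integral_of_le (by linarith), ← intervalIntegral.integral_add_adjacent_intervals i2 i1, v1, v2]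
  · ring_nf
  · exact (intervalIntegrable_iff_integrableOn_Icc_of_le (by linarith)).1 i3
  · exact Filter.Eventually.of_forall (fun x => by positivity)

/-- **L² bound on the Duhamel term in the low-frequency region `{ξ² ≤ 1/t₁}`.** For `a > 0`,
`0 ≤ γ < 1/2`, `δ > 0` with `γ + δ < 1/2`, there is `C > 0` depending only on
`a, γ, δ` such that: if `F` is measurable with a.e. coupled `C¹` Fourier modes solving
`F_t(t,ξ) = −iξ² F(t,ξ) + ia² t^{−1−2ia²} conj(F(t,−ξ))`, and
`|ξ|^γ |F(1,ξ)| ≤ M` for a.e. `|ξ| ≤ 1`, then for all `1 ≤ t₁ ≤ t₂` the function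
`A_{t₁,t₂}(ξ) = ∫_{t₁}^{t₂} e^{isξ²} conj(F(s,−ξ)) s^{−1−2ia²} ds` satisfies
`‖A_{t₁,t₂}‖_{L²(low-frequency region `{ξ² ≤ 1/t₁}`)} ≤ C t₁^{−1/4+(γ+δ)/2} M`. -/
theorem stmt_10
    (a γ δ : ℝ) (ha : 0 < a) (hγ : 0 ≤ γ) (hγhalf : γ < 1/2) (hδ : 0 < δ)
    (hγδ : γ + δ < 1/2) :
    ∃ C : ℝ, 0 < C ∧ ∀ (F : ℝ → ℝ → ℂ) (M : ℝ),
      Measurable (fun p : ℝ × ℝ => F p.1 p.2) →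
      (∀ᵐ ξ : ℝ, ∀ t ∈ Set.Ici (1:ℝ),
        HasDerivWithinAt (fun s => F s ξ)
          (-(Complex.I * (ξ:ℂ)^2) * F t ξ
            + Complex.I * (a:ℂ)^2 * (t:ℂ) ^ ((-1:ℂ) - 2*Complex.I*(a:ℂ)^2)
                * (starRingEnd ℂ) (F t (-ξ))) (Set.Ici 1) t ∧
        HasDerivWithinAt (fun s => F s (-ξ))
          (-(Complex.I * (ξ:ℂ)^2) * F t (-ξ)
            + Complex.I * (a:ℂ)^2 * (t:ℂ) ^ ((-1:ℂ) - 2*Complex.I*(a:ℂ)^2)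
                * (starRingEnd ℂ) (F t ξ)) (Set.Ici 1) t) →
      (∀ᵐ ξ : ℝ, |ξ| ≤ 1 → |ξ| ^ γ * ‖F 1 ξ‖ ≤ M) →
      ∀ t₁ t₂ : ℝ, 1 ≤ t₁ → t₁ ≤ t₂ →
        eLpNorm (fun ξ : ℝ => ∫ s in t₁..t₂,
            Complex.exp (Complex.I * (s:ℂ) * (ξ:ℂ)^2) * (starRingEnd ℂ) (F s (-ξ))
              * (s:ℂ) ^ ((-1:ℂ) - 2*Complex.I*(a:ℂ)^2))
          2 (volume.restrict {ξ : ℝ | ξ^2 ≤ 1 / t₁})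
        ≤ ENNReal.ofReal (C * t₁ ^ (-1/4 + (γ + δ)/2) * M) := by
  obtain ⟨K, hK, hpair⟩ := pair_bound (a := a) (σ := δ / 2) ha (by linarith) (by linarith)
  have hs : 0 < 1 - 2 * (γ + δ) := by linarith
  set L := Real.sqrt (2 / (1 - 2 * (γ + δ))) with hL
  have hLpos : 0 < L := Real.sqrt_pos.2 (by positivity)
  refine ⟨4 * K / a ^ 2 * L, by positivity, ?_⟩
  intro F M _ hF hM t₁ t₂ h1 h2
  have hM0 : 0 ≤ M := by
    by_contra hneg
    have : ∀ᵐ ξ : ℝ, ξ ∉ Set.Icc (-1:ℝ) 1 := by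
      filter_upwards [hM] with ξ hξ hmem
      have := hξ (abs_le.2 hmem)
      have : 0 ≤ |ξ| ^ γ * ‖F 1 ξ‖ := by positivity
      linarith
    have h0 := measure_eq_zero_iff_ae_notMem.2 this
    rw [Real.volume_Icc] at h0
    norm_num at h0
  have hMneg : ∀ᵐ ξ : ℝ, |ξ| ≤ 1 → |ξ| ^ γ * ‖F 1 (-ξ)‖ ≤ M := by
    have := (Measure.measurePreserving_neg (volume : Measure ℝ)).quasiMeasurePreserving.ae hM
    filter_upwards [this] with ξ hξ
    simpa using hξ
  have hne : ∀ᵐ ξ : ℝ, ξ ≠ 0 := by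
    exact Measure.ae_ne volume 0
  have ht0 : 0 < t₁ := by linarith
  set R := t₁ ^ (-(1/2) : ℝ) with hR
  have hRpos : 0 < R := Real.rpow_pos_of_pos ht0 _
  have hR2 : R ^ 2 = 1 / t₁ := by
    have he : (-(1/2) : ℝ) * ((2:ℕ) : ℝ) = -1 := by norm_num
    rw [hR, ← Real.rpow_natCast, ← Real.rpow_mul ht0.le, he, Real.rpow_neg_one, one_div]
  have hR1 : R ≤ 1 := Real.rpow_le_one_of_one_le_of_nonpos h1 (by norm_num)
  have hset : {ξ : ℝ | ξ^2 ≤ 1 / t₁} = Set.Icc (-R) R := by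
    ext ξ
    rw [Set.mem_ofPred_eq, ← hR2, sq_le_sq, abs_of_pos hRpos, Set.mem_Icc, abs_le]
  rw [hset]
  set B := 4 * K / a ^ 2 * M with hB
  have hB0 : 0 ≤ B := by positivity
  have hbound : ∀ᵐ ξ : ℝ ∂(volume.restrict (Set.Icc (-R) R)), ‖∫ s in t₁..t₂,
            Complex.exp (Complex.I * (s:ℂ) * (ξ:ℂ)^2) * (starRingEnd ℂ) (F s (-ξ))
              * (s:ℂ) ^ ((-1:ℂ) - 2*Complex.I*(a:ℂ)^2)‖ ≤ B * |ξ| ^ (-(γ + δ)) := by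
    filter_upwards [ae_restrict_of_ae hF, ae_restrict_of_ae hM, ae_restrict_of_ae hMneg,
      ae_restrict_of_ae hne, ae_restrict_mem measurableSet_Icc] with ξ e1 e2 e3 e4 e5
    have hξ1 : |ξ| ≤ 1 := (abs_le.2 e5).trans hR1
    have hξ0 : 0 < |ξ| := abs_pos.2 e4
    have hb := hpair ξ (fun s => F s ξ) (fun s => F s (-ξ)) e4 hξ1 (fun t ht => (e1 t ht).1)
      (fun t ht => (e1 t ht).2)
    have hd := duhamel_bound ha ξ (fun s => F s ξ) (fun s => F s (-ξ)) (fun t ht => (e1 t ht).1)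
      (fun t ht => (e1 t ht).2.continuousWithinAt) h1 h2
    refine hd.trans ?_
    have hq : |ξ| ^ (-γ) * |ξ| ^ γ = 1 := by rw [← Real.rpow_add hξ0]; simp
    have hi : ‖F 1 ξ‖ + ‖F 1 (-ξ)‖ ≤ |ξ| ^ (-γ) * (2 * M) := by
      calc ‖F 1 ξ‖ + ‖F 1 (-ξ)‖ = (|ξ| ^ (-γ) * |ξ| ^ γ) * (‖F 1 ξ‖ + ‖F 1 (-ξ)‖) := by rw [hq, one_mul]
        _ = |ξ| ^ (-γ) * (|ξ| ^ γ * ‖F 1 ξ‖ + |ξ| ^ γ * ‖F 1 (-ξ)‖) := by ring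
        _ ≤ _ := by
          have := e2 hξ1
          have := e3 hξ1
          gcongr; linarith
    have hall : ∀ t, 1 ≤ t → ‖F t ξ‖ ≤ 2 * K * M * |ξ| ^ (-(γ + δ)) := by
      intro t ht
      refine (hb t ht).trans ?_
      calc K * |ξ| ^ (-(2 * (δ / 2))) * (‖F 1 ξ‖ + ‖F 1 (-ξ)‖)
          ≤ K * |ξ| ^ (-(2 * (δ / 2))) * (|ξ| ^ (-γ) * (2 * M)) := by gcongr
        _ = 2 * K * M * (|ξ| ^ (-(2 * (δ / 2))) * |ξ| ^ (-γ)) := by ring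
        _ = _ := by rw [← Real.rpow_add hξ0]; congr 2; ring
    have b1 := hall t₁ h1
    have b2 := hall t₂ (h1.trans h2)
    calc _ ≤ (2 * K * M * |ξ| ^ (-(γ + δ)) + 2 * K * M * |ξ| ^ (-(γ + δ))) / a ^ 2 := by gcongr
      _ = _ := by rw [hB]; ring
  refine (eLpNorm_mono_ae_real hbound).trans ?_
  rw [eLpNorm_eq_lintegral_rpow_enorm_toReal (by norm_num) (by norm_num)]
  have hpt : ∀ ξ : ℝ, ‖B * |ξ| ^ (-(γ + δ))‖ₑ ^ (2:ENNReal).toReal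
      = ENNReal.ofReal (B ^ 2) * ENNReal.ofReal (|ξ| ^ (-(2 * (γ + δ)))) := by
    intro ξ
    rw [Real.enorm_of_nonneg (by positivity), ENNReal.ofReal_rpow_of_nonneg (by positivity) (by norm_num),
      ← ENNReal.ofReal_mul (by positivity)]
    congr 1
    simp only [ENNReal.toReal_ofNat, Real.rpow_two, mul_pow]
    rw [← Real.rpow_natCast (|ξ| ^ _), ← Real.rpow_mul (abs_nonneg _)]
    congr 2; push_cast; ring
  simp only [hpt]
  rw [lintegral_const_mul' _ _ ENNReal.ofReal_ne_top, lint (by linarith) hRpos,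
    ← ENNReal.ofReal_mul (by positivity), ENNReal.ofReal_rpow_of_nonneg (by positivity) (by norm_num)]
  apply ENNReal.ofReal_le_ofReal
  apply le_of_eq
  have hRt : R ^ (1 - 2 * (γ + δ)) = (t₁ ^ (-1/4 + (γ + δ)/2)) ^ 2 := by
    rw [hR, ← Real.rpow_mul ht0.le, ← Real.rpow_natCast, ← Real.rpow_mul ht0.le]
    congr 1; push_cast; ring
  have hL2 : L ^ 2 = 2 / (1 - 2 * (γ + δ)) := Real.sq_sqrt (by positivity)
  have : B ^ 2 * (2 * (R ^ (1 - 2 * (γ + δ)) / (1 - 2 * (γ + δ))))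
      = (4 * K / a ^ 2 * L * t₁ ^ (-1/4 + (γ + δ)/2) * M) ^ 2 := by
    rw [hRt]
    calc _ = B ^ 2 * (2 / (1 - 2 * (γ + δ))) * (t₁ ^ (-1/4 + (γ + δ)/2)) ^ 2 := by ring
      _ = _ := by rw [← hL2, hB]; ring
  rw [this]
  simp only [ENNReal.toReal_ofNat]
  rw [← Real.sqrt_eq_rpow, Real.sqrt_sq (by positivity)]
end
end
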